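/- Let q ∈ ℂ, N ≥ 2, and let u : ℤ^N → ℂ (arguments written u(x_N, …, x_1)) satisfy the boundary relation: for every 2 ≤ i ≤ N, every a ∈ ℤ, and all other arguments fixed, u(x_N, …, x_{i+1}, a, a-1, x_{i-2}, …, x_1) = q·u(x_N, …, x_{i+1}, a-1, a, x_{i-2}, …, x_1) - (q-1)·u(x_N, …, x_{i+1}, a, a, x_{i-2}, …, x_1), the displayed pair occupying the i-th and (i-1)-th rightmost slots. Fix K ≥ 0 and n ≥ 1 with K + n ≤ N, fix x ∈ ℤ, and let X = (x_N, …, x_1) ∈ ℤ^N satisfy x_{K+1} = ⋯ = x_{K+n} = x. For 1 ≤ i ≤ n, let X_i denote X with its (K+n-i+1)-th rightmost coordinate replaced by x - 1. Then ∑_{i=1}^n u(X_i) = [n]_q · u(X_1) - ([n]_q - n) · u(X). -/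

import Mathlib

/-- The boundary relation for `u : ℤ^N → ℂ` (arguments written `u(x_N, …, x_1)`,
with the `i`-th rightmost coordinate stored at index `i - 1`): for every
`2 ≤ i ≤ N` and `a ∈ ℤ`,
`u(…, a, a-1, …) = q·u(…, a-1, a, …) - (q-1)·u(…, a, a, …)`,
the displayed pair occupying the `i`-th and `(i-1)`-th rightmost slots
(indices `j+1` and `j` below, where `j = i - 2`). -/
def BoundaryRel (q : ℂ) (N : ℕ) (u : (Fin N → ℤ) → ℂ) : Prop :=
  ∀ (X : Fin N → ℤ) (j : ℕ) (hj : j + 1 < N) (a : ℤ),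
    u (Function.update (Function.update X ⟨j + 1, hj⟩ a) ⟨j, by omega⟩ (a - 1)) =
      q * u (Function.update (Function.update X ⟨j + 1, hj⟩ (a - 1)) ⟨j, by omega⟩ a)
        - (q - 1) *
            u (Function.update (Function.update X ⟨j + 1, hj⟩ a) ⟨j, by omega⟩ a)

/-- The `q`-integer `[k]_q = 1 + q + ⋯ + q^(k-1)`. -/
noncomputable def qnum (q : ℂ) (k : ℕ) : ℂ := ∑ i ∈ Finset.range k, q ^ i

/-- Inside a block of coordinates equal to `x`, the boundary relation moves a decremented coordinate
one slot to the left. -/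
theorem BoundaryRel.update_sub_one {q : ℂ} {N : ℕ} {u : (Fin N → ℤ) → ℂ} (hu : BoundaryRel q N u)
    {X : Fin N → ℤ} {x : ℤ} {j : ℕ} (hj : j + 1 < N) (h₀ : X ⟨j, by omega⟩ = x)
    (h₁ : X ⟨j + 1, hj⟩ = x) :
    u (Function.update X ⟨j, by omega⟩ (x - 1)) =
      q * u (Function.update X ⟨j + 1, hj⟩ (x - 1)) - (q - 1) * u X := by
  have h := hu X j hj x
  have hne : (⟨j, by omega⟩ : Fin N) ≠ ⟨j + 1, hj⟩ := by simp
  have e₁ : Function.update X ⟨j + 1, hj⟩ x = X := by rw [← h₁, Function.update_eq_self]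
  have e₀ : Function.update X ⟨j, by omega⟩ x = X := by rw [← h₀, Function.update_eq_self]
  rwa [e₁, e₀, Function.update_comm hne.symm, e₀] at h

/-- Iterating the boundary relation `i` times inside a block of coordinates equal to `x`. -/
theorem BoundaryRel.update_sub_one_iterate {q : ℂ} {N : ℕ} {u : (Fin N → ℤ) → ℂ}
    (hu : BoundaryRel q N u) {X : Fin N → ℤ} {x : ℤ} {m : ℕ} (hm : m < N) (i : ℕ) (hi : i ≤ m)
    (hX : ∀ (l : ℕ) (hl : l < N), m - i ≤ l → l ≤ m → X ⟨l, hl⟩ = x) :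
    u (Function.update X ⟨m - i, by omega⟩ (x - 1)) =
      q ^ i * u (Function.update X ⟨m, hm⟩ (x - 1)) - (q ^ i - 1) * u X := by
  induction i with
  | zero => simp
  | succ i ih =>
    have h := ih (by omega) fun l hl h₁ h₂ => hX l hl (by omega) h₂
    have hs := hu.update_sub_one (j := m - (i + 1)) (by omega)
      (hX _ _ (by omega) (by omega)) (hX _ _ (by omega) (by omega))
    have e : m - (i + 1) + 1 = m - i := by omega
    simp only [e] at hs
    rw [hs, h]
    ring

/-- Let `u : ℤ^N → ℂ` satisfy the boundary relation.  Fix `K ≥ 0`,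
`n ≥ 1` with `K + n ≤ N`, `x ∈ ℤ`, and let `X = (x_N, …, x_1)` satisfy
`x_{K+1} = ⋯ = x_{K+n} = x`.  For `1 ≤ i ≤ n`, let `X_i` denote `X` with its
`(K+n-i+1)`-th rightmost coordinate replaced by `x - 1`.  Then
`∑_{i=1}^n u(X_i) = [n]_q · u(X_1) - ([n]_q - n) · u(X)`.
(Below the sum runs over `i ∈ {0, …, n-1}`, the summand being `u(X_{i+1})`.) -/
theorem boundary_sum (q : ℂ) (N : ℕ) (hN : 2 ≤ N) (u : (Fin N → ℤ) → ℂ)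
    (hu : BoundaryRel q N u) (K n : ℕ) (hn : 1 ≤ n) (hKn : K + n ≤ N) (x : ℤ)
    (X : Fin N → ℤ)
    (hX : ∀ (l : ℕ) (hl : l < N), K ≤ l → l < K + n → X ⟨l, hl⟩ = x) :
    ∑ i ∈ Finset.range n, u (Function.update X ⟨K + n - 1 - i, by omega⟩ (x - 1)) =
      qnum q n * u (Function.update X ⟨K + n - 1, by omega⟩ (x - 1))
        - (qnum q n - (n : ℂ)) * u X := by
  have key : ∀ i ∈ Finset.range n,
      u (Function.update X ⟨K + n - 1 - i, by omega⟩ (x - 1)) =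
        q ^ i * u (Function.update X ⟨K + n - 1, by omega⟩ (x - 1)) - (q ^ i - 1) * u X := by
    intro i hi
    rw [Finset.mem_range] at hi
    exact hu.update_sub_one_iterate (by omega) i (by omega)
      fun l hl h₁ h₂ => hX l hl (by omega) (by omega)
  rw [Finset.sum_congr rfl key, Finset.sum_sub_distrib, ← Finset.sum_mul, ← Finset.sum_mul,
    Finset.sum_sub_distrib]
  simp [qnum]
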